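/- arXiv:1706.01254 — 2 statements merged into one kernel-verified Lean document; each statement's English description precedes it below -/
import Mathlib

section
/- For every R > 0, the function λ ↦ g(λ, z_Pe(λ)) defined on (0,1) has a continuous extension to the endpoints: g(λ, z_Pe(λ)) tends to 1/(2k11) + 1/(2k21) as λ → 0⁺ and tends to 1/(2k22) + 1/(2k12) as λ → 1⁻. -/
/-- The Principal's reduced objective `g(λ, z)` in the model with a Planner. -/
noncomputable def g (k11 k12 k21 k22 R lam : ℝ) (z : Fin 2 → Fin 2 → ℝ) : ℝ :=
  -(R / 2) * (z 0 0 + z 0 1 - 1) ^ 2 - (R / 2) * (z 1 0 + z 1 1 - 1) ^ 2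
    + (lam * z 0 0 + (1 - lam) * z 0 1) * (1 / (lam * k11) + 1 / ((1 - lam) * k12))
    + (lam * z 1 0 + (1 - lam) * z 1 1) * (1 / ((1 - lam) * k22) + 1 / (lam * k21))
    - (lam * z 0 0 + (1 - lam) * z 0 1) ^ 2 / (2 * lam ^ 2 * k11)
    - (lam * z 1 0 + (1 - lam) * z 1 1) ^ 2 / (2 * lam ^ 2 * k21)
    - (lam * z 1 0 + (1 - lam) * z 1 1) ^ 2 / (2 * (1 - lam) ^ 2 * k22)
    - (lam * z 0 0 + (1 - lam) * z 0 1) ^ 2 / (2 * (1 - lam) ^ 2 * k12)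

/-- The Pareto-optimal sensitivities `z_Pe(λ)`. -/
noncomputable def zPe (k11 k12 k21 k22 lam : ℝ) : Fin 2 → Fin 2 → ℝ :=
  ![![(1 - lam) ^ 2 * k12 / (lam ^ 2 * k11 + (1 - lam) ^ 2 * k12),
      lam ^ 2 * k11 / (lam ^ 2 * k11 + (1 - lam) ^ 2 * k12)],
    ![(1 - lam) ^ 2 * k22 / (lam ^ 2 * k21 + (1 - lam) ^ 2 * k22),
      lam ^ 2 * k21 / (lam ^ 2 * k21 + (1 - lam) ^ 2 * k22)]]

/-- Contribution of one agent to the Principal's reduced objective at the Pareto-optimal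
sensitivities, as a function that is also continuous at the endpoints of `(0,1)`. -/
noncomputable def paretoValue (a b lam : ℝ) : ℝ :=
  ((1 - lam) * b + lam * a) ^ 2 / (2 * (lam ^ 2 * a + (1 - lam) ^ 2 * b) * (a * b))

theorem pareto_denom_pos {a b : ℝ} (ha : 0 < a) (hb : 0 < b) (lam : ℝ) :
    0 < lam ^ 2 * a + (1 - lam) ^ 2 * b := by
  rcases eq_or_ne lam 0 with rfl | h
  · simpa using hb
  · positivity

theorem continuous_paretoValue {a b : ℝ} (ha : 0 < a) (hb : 0 < b) :
    Continuous (paretoValue a b) := by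
  unfold paretoValue
  refine Continuous.div (by fun_prop) (by fun_prop) fun lam => ?_
  have := pareto_denom_pos ha hb lam
  positivity

theorem paretoValue_zero {a b : ℝ} (ha : 0 < a) (hb : 0 < b) : paretoValue a b 0 = 1 / (2 * a) := by
  unfold paretoValue
  simp only [sub_zero]
  field_simp
  ring

theorem paretoValue_one {a b : ℝ} (ha : 0 < a) (hb : 0 < b) : paretoValue a b 1 = 1 / (2 * b) := by
  unfold paretoValue
  simp only [sub_self]
  field_simp
  ring

theorem pareto_weighted_sum (a b lam : ℝ) :
    lam * ((1 - lam) ^ 2 * b / (lam ^ 2 * a + (1 - lam) ^ 2 * b))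
      + (1 - lam) * (lam ^ 2 * a / (lam ^ 2 * a + (1 - lam) ^ 2 * b))
      = lam * (1 - lam) * ((1 - lam) * b + lam * a) / (lam ^ 2 * a + (1 - lam) ^ 2 * b) := by
  ring

theorem pareto_sum_eq_one {a b : ℝ} (ha : 0 < a) (hb : 0 < b) (lam : ℝ) :
    (1 - lam) ^ 2 * b / (lam ^ 2 * a + (1 - lam) ^ 2 * b)
      + lam ^ 2 * a / (lam ^ 2 * a + (1 - lam) ^ 2 * b) = 1 := by
  rw [← add_div, add_comm, div_self (pareto_denom_pos ha hb lam).ne']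

theorem pareto_gain_sub_cost {a b l m D : ℝ} (ha : a ≠ 0) (hb : b ≠ 0) (hl : l ≠ 0)
    (hm : m ≠ 0) (hD : D ≠ 0) (h : D = l ^ 2 * a + m ^ 2 * b) :
    l * m * (m * b + l * a) / D * (1 / (l * a) + 1 / (m * b))
      - (l * m * (m * b + l * a) / D) ^ 2 / (2 * l ^ 2 * a)
      - (l * m * (m * b + l * a) / D) ^ 2 / (2 * m ^ 2 * b)
      = (m * b + l * a) ^ 2 / (2 * D * (a * b)) := by
  field_simp
  rw [h]
  ring

theorem g_zPe_eq {k11 k12 k21 k22 : ℝ} (hk11 : 0 < k11) (hk12 : 0 < k12) (hk21 : 0 < k21)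
    (hk22 : 0 < k22) (R : ℝ) {lam : ℝ} (h : lam ∈ Set.Ioo (0 : ℝ) 1) :
    g k11 k12 k21 k22 R lam (zPe k11 k12 k21 k22 lam)
      = paretoValue k11 k12 lam + paretoValue k21 k22 lam := by
  have hm : 1 - lam ≠ 0 := (sub_pos.2 h.2).ne'
  have h1 := pareto_gain_sub_cost hk11.ne' hk12.ne' h.1.ne' hm
    (pareto_denom_pos hk11 hk12 lam).ne' rfl
  have h2 := pareto_gain_sub_cost hk21.ne' hk22.ne' h.1.ne' hm
    (pareto_denom_pos hk21 hk22 lam).ne' rfl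
  simp only [g, zPe, paretoValue, Matrix.cons_val_zero, Matrix.cons_val_one,
    pareto_weighted_sum, pareto_sum_eq_one hk11 hk12, pareto_sum_eq_one hk21 hk22]
  linear_combination h1 + h2

/-- for every `R > 0`, `λ ↦ g(λ, z_Pe(λ))` on `(0,1)` extends continuously to the
endpoints: it tends to `1/(2 k11) + 1/(2 k21)` as `λ → 0⁺` and to `1/(2 k22) + 1/(2 k12)` as
`λ → 1⁻` (limits along `(0,1)`). -/
theorem g_zPe_boundary_limits (k11 k12 k21 k22 : ℝ)
    (hk11 : 0 < k11) (hk12 : 0 < k12) (hk21 : 0 < k21) (hk22 : 0 < k22)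
    (R : ℝ) (hR : 0 < R) :
    Filter.Tendsto (fun lam => g k11 k12 k21 k22 R lam (zPe k11 k12 k21 k22 lam))
        (nhdsWithin 0 (Set.Ioo (0 : ℝ) 1)) (nhds (1 / (2 * k11) + 1 / (2 * k21))) ∧
      Filter.Tendsto (fun lam => g k11 k12 k21 k22 R lam (zPe k11 k12 k21 k22 lam))
        (nhdsWithin 1 (Set.Ioo (0 : ℝ) 1)) (nhds (1 / (2 * k22) + 1 / (2 * k12))) := by
  have hcont : Continuous fun lam => paretoValue k11 k12 lam + paretoValue k21 k22 lam :=
    (continuous_paretoValue hk11 hk12).add (continuous_paretoValue hk21 hk22)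
  have heq (x : ℝ) : (fun lam => paretoValue k11 k12 lam + paretoValue k21 k22 lam)
      =ᶠ[nhdsWithin x (Set.Ioo (0 : ℝ) 1)]
        fun lam => g k11 k12 k21 k22 R lam (zPe k11 k12 k21 k22 lam) :=
    eventually_nhdsWithin_of_forall fun _ h => (g_zPe_eq hk11 hk12 hk21 hk22 R h).symm
  constructor
  · rw [← paretoValue_zero hk11 hk12, ← paretoValue_zero hk21 hk22]
    exact ((hcont.tendsto 0).mono_left nhdsWithin_le_nhds).congr' (heq 0)
  · rw [add_comm (1 / (2 * k22)), ← paretoValue_one hk11 hk12,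
      ← paretoValue_one hk21 hk22]
    exact ((hcont.tendsto 1).mono_left nhdsWithin_le_nhds).congr' (heq 1)
end

section
/- For every R > 0, g_NA(z_NA(R), R) > 1/(2k11) + 1/(2k21) and g_NA(z_NA(R), R) > 1/(2k22) + 1/(2k12); i.e. the no-Planner value of the Principal is strictly better than the value obtained when a Planner chooses a weak Pareto optimum (λ = 0 or λ = 1). -/
/-- The Principal's reduced objective `g_NA(z, R)` in the no-Planner (Nash) model. -/
noncomputable def gNA (k11 k12 k21 k22 : ℝ) (z : Fin 2 → Fin 2 → ℝ) (R : ℝ) : ℝ :=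
  -(R / 2) * (z 0 0 + z 0 1 - 1) ^ 2 - (R / 2) * (z 1 0 + z 1 1 - 1) ^ 2
    + z 0 0 / k11 + z 0 1 / k12 + z 1 0 / k21 + z 1 1 / k22
    - (z 0 0) ^ 2 / (2 * k11) - (z 0 1) ^ 2 / (2 * k12)
    - (z 1 0) ^ 2 / (2 * k21) - (z 1 1) ^ 2 / (2 * k22)

/-- The optimal sensitivities `z_NA(R)` in the no-Planner (Nash) model. -/
noncomputable def zNA (k11 k12 k21 k22 R : ℝ) : Fin 2 → Fin 2 → ℝ :=
  ![![(1 + R * k12) / (1 + R * (k11 + k12)), (1 + R * k11) / (1 + R * (k11 + k12))],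
    ![(1 + R * k22) / (1 + R * (k21 + k22)), (1 + R * k21) / (1 + R * (k21 + k22))]]

/-- One row of the no-Planner objective at the optimal sensitivities, in closed form. -/
theorem noPlanner_row_value {a b R : ℝ} (ha : 0 < a) (hb : 0 < b) (hR : 0 < R) :
    -(R / 2) * ((1 + R * b) / (1 + R * (a + b)) + (1 + R * a) / (1 + R * (a + b)) - 1) ^ 2
      + (1 + R * b) / (1 + R * (a + b)) / a + (1 + R * a) / (1 + R * (a + b)) / b
      - ((1 + R * b) / (1 + R * (a + b))) ^ 2 / (2 * a)
      - ((1 + R * a) / (1 + R * (a + b))) ^ 2 / (2 * b)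
      = 1 / (2 * a) + 1 / (2 * b) - R / (2 * (1 + R * (a + b))) := by
  have hD : 1 + R * (a + b) ≠ 0 := by positivity
  field_simp
  ring

theorem noPlanner_penalty_lt {a b R : ℝ} (ha : 0 < a) (hb : 0 < b) (hR : 0 < R) :
    R / (2 * (1 + R * (a + b))) < 1 / (2 * a) := by
  rw [div_lt_div_iff₀ (by positivity) (by positivity)]
  nlinarith [mul_pos hR hb]

theorem gNA_zNA {k11 k12 k21 k22 R : ℝ}
    (hk11 : 0 < k11) (hk12 : 0 < k12) (hk21 : 0 < k21) (hk22 : 0 < k22) (hR : 0 < R) :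
    gNA k11 k12 k21 k22 (zNA k11 k12 k21 k22 R) R
      = (1 / (2 * k11) + 1 / (2 * k12) - R / (2 * (1 + R * (k11 + k12))))
        + (1 / (2 * k21) + 1 / (2 * k22) - R / (2 * (1 + R * (k21 + k22)))) := by
  rw [← noPlanner_row_value hk11 hk12 hR, ← noPlanner_row_value hk21 hk22 hR]
  simp only [gNA, zNA, Matrix.cons_val_zero, Matrix.cons_val_one]
  ring

/-- for every `R > 0`, `g_NA(z_NA(R), R) > 1/(2 k11) + 1/(2 k21)` and
`g_NA(z_NA(R), R) > 1/(2 k22) + 1/(2 k12)`: the no-Planner value of the Principal strictly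
beats the values of the weak Pareto optima (`λ = 0` or `λ = 1`). -/
theorem noPlanner_beats_weak_pareto (k11 k12 k21 k22 : ℝ)
    (hk11 : 0 < k11) (hk12 : 0 < k12) (hk21 : 0 < k21) (hk22 : 0 < k22)
    (R : ℝ) (hR : 0 < R) :
    1 / (2 * k11) + 1 / (2 * k21) < gNA k11 k12 k21 k22 (zNA k11 k12 k21 k22 R) R ∧
      1 / (2 * k22) + 1 / (2 * k12) < gNA k11 k12 k21 k22 (zNA k11 k12 k21 k22 R) R := by
  rw [gNA_zNA hk11 hk12 hk21 hk22 hR]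
  have h11 := noPlanner_penalty_lt hk11 hk12 hR
  have h12 := noPlanner_penalty_lt hk12 hk11 hR
  have h21 := noPlanner_penalty_lt hk21 hk22 hR
  have h22 := noPlanner_penalty_lt hk22 hk21 hR
  rw [add_comm k12 k11] at h12
  rw [add_comm k22 k21] at h22
  constructor <;> linarith
end
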